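/- arXiv:2501.04530 — 2 statements merged into one kernel-verified Lean document; each statement's English description precedes it below -/
import Mathlib

section
/- Suppose μ₁ = μ₂ = μ and the holomorphically nondegenerate polynomial model M_P admits the nilpotent rotation Y = z₁∂_{z₂} as an infinitesimal symmetry, i.e. Re(z₁·∂P/∂z₂) ≡ 0. Then M_P has no exotic symmetry: every rigid infinitesimal symmetry X = f₁∂_{z₁}+f₂∂_{z₂} of M_P that is weighted homogeneous of weighted degree ν for some ν ∈ (0,1) is identically zero. -/
/-!
STATEMENT 0: A diagonal field `Y = λ₁z₁∂_{z₁} + λ₂z₂∂_{z₂}` with real `λⱼ` satisfies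
`Re(YP) ≡ 0` iff every monomial of `P` has weight `0` w.r.t. `(λ₁, λ₂)`.

A real-valued polynomial `P(z, z̄)` on `ℂ²` is encoded by its finitely supported
coefficient function `c : ((ℕ × ℕ) × (ℕ × ℕ)) →₀ ℂ`, where the index
`((a₁, a₂), (b₁, b₂))` corresponds to the monomial `z₁^{a₁} z₂^{a₂} z̄₁^{b₁} z̄₂^{b₂}`.
-/

open Complex

/-- Index of a monomial `z₁^{a₁} z₂^{a₂} z̄₁^{b₁} z̄₂^{b₂}`. -/
abbrev MonIdx := (ℕ × ℕ) × (ℕ × ℕ)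

/-- The monomial `z₁^{a₁} z₂^{a₂} z̄₁^{b₁} z̄₂^{b₂}` as a function of `z = (z₁, z₂) ∈ ℂ²`. -/
noncomputable def monFn (k : MonIdx) (z : ℂ × ℂ) : ℂ :=
  z.1 ^ k.1.1 * z.2 ^ k.1.2 * (starRingEnd ℂ z.1) ^ k.2.1 * (starRingEnd ℂ z.2) ^ k.2.2

/-- The value `P(z, z̄)` of the polynomial with coefficients `c`. -/
noncomputable def evalP (c : MonIdx →₀ ℂ) (z : ℂ × ℂ) : ℂ :=
  c.sum fun k v => v * monFn k z

/-- The reality condition `c_{b,a} = conj (c_{a,b})`, i.e. `P` is real valued. -/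
def RealCoeff (c : MonIdx →₀ ℂ) : Prop :=
  ∀ a b : ℕ × ℕ, c (b, a) = starRingEnd ℂ (c (a, b))

/-- The formal partial derivative `∂P/∂z₁` (differentiating only the holomorphic
variable `z₁`, treating `z̄₁, z̄₂` as constants), evaluated at `z`. -/
noncomputable def dz1P (c : MonIdx →₀ ℂ) (z : ℂ × ℂ) : ℂ :=
  c.sum fun k v => v * (k.1.1 : ℂ) * z.1 ^ (k.1.1 - 1) * z.2 ^ k.1.2 *
    (starRingEnd ℂ z.1) ^ k.2.1 * (starRingEnd ℂ z.2) ^ k.2.2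

/-- The formal partial derivative `∂P/∂z₂`, evaluated at `z`. -/
noncomputable def dz2P (c : MonIdx →₀ ℂ) (z : ℂ × ℂ) : ℂ :=
  c.sum fun k v => v * (k.1.2 : ℂ) * z.1 ^ k.1.1 * z.2 ^ (k.1.2 - 1) *
    (starRingEnd ℂ z.1) ^ k.2.1 * (starRingEnd ℂ z.2) ^ k.2.2

/-- Evaluation of a holomorphic polynomial `f ∈ ℂ[z₁,z₂]` at `z = (z₁,z₂)`. -/
noncomputable def evalF2 (f : MvPolynomial (Fin 2) ℂ) (z : ℂ × ℂ) : ℂ :=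
  MvPolynomial.eval ![z.1, z.2] f

/-- Weighted homogeneity of a holomorphic polynomial in `(z₁,z₂)` of weighted
degree `d` with respect to weights `(μ₁, μ₂)`. -/
def WHom2 (mu1 mu2 d : ℝ) (f : MvPolynomial (Fin 2) ℂ) : Prop :=
  ∀ m : Fin 2 →₀ ℕ, MvPolynomial.coeff m f ≠ 0 →
    mu1 * (m 0 : ℝ) + mu2 * (m 1 : ℝ) = d

/-- Holomorphic nondegeneracy of the model `M_P`: there is no nonzero pair
`(g₁, g₂)` of holomorphic polynomials in `(z₁,z₂)` with `g₁∂P/∂z₁ + g₂∂P/∂z₂ ≡ 0`. -/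
def HolNondeg (c : MonIdx →₀ ℂ) : Prop :=
  ∀ g1 g2 : MvPolynomial (Fin 2) ℂ,
    (∀ z : ℂ × ℂ, evalF2 g1 z * dz1P c z + evalF2 g2 z * dz2P c z = 0) →
    g1 = 0 ∧ g2 = 0

namespace NilpotentRotation

open MvPolynomial

/-- The derivation `X i * ∂/∂X j` of a polynomial ring. -/
noncomputable def rot {σ : Type*} (i j : σ) (p : MvPolynomial σ ℂ) : MvPolynomial σ ℂ :=
  X i * pderiv j p

/-- A holomorphic polynomial in `z`, viewed as a polynomial in `(z, z̄)`. -/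
noncomputable def hol (f : MvPolynomial (Fin 2) ℂ) : MvPolynomial (Fin 2 ⊕ Fin 2) ℂ :=
  rename Sum.inl f

/-- The complex conjugate of a holomorphic polynomial, as a polynomial in `(z, z̄)`. -/
noncomputable def antihol (f : MvPolynomial (Fin 2) ℂ) : MvPolynomial (Fin 2 ⊕ Fin 2) ℂ :=
  rename Sum.inr (map (starRingEnd ℂ) f)

/-- The action on polynomials in `(z, z̄)` of twice the real part of `f₁∂_{z₁} + f₂∂_{z₂}`. -/
noncomputable def realField (f : MvPolynomial (Fin 2) ℂ × MvPolynomial (Fin 2) ℂ)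
    (P : MvPolynomial (Fin 2 ⊕ Fin 2) ℂ) : MvPolynomial (Fin 2 ⊕ Fin 2) ℂ :=
  hol f.1 * pderiv (Sum.inl 0) P + hol f.2 * pderiv (Sum.inl 1) P +
    antihol f.1 * pderiv (Sum.inr 0) P + antihol f.2 * pderiv (Sum.inr 1) P

/-- The bracket of `z₁∂_{z₂}` with `f₁∂_{z₁} + f₂∂_{z₂}`. -/
noncomputable def bracket (f : MvPolynomial (Fin 2) ℂ × MvPolynomial (Fin 2) ℂ) :
    MvPolynomial (Fin 2) ℂ × MvPolynomial (Fin 2) ℂ :=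
  (rot 0 1 f.1, rot 0 1 f.2 - f.1)

/-- The point `(z, z̄)`. -/
noncomputable def conjPoint (z : ℂ × ℂ) : Fin 2 ⊕ Fin 2 → ℂ :=
  Sum.elim ![z.1, z.2] ![starRingEnd ℂ z.1, starRingEnd ℂ z.2]

/-- The polynomial in `(z, z̄)` with coefficients `c`. -/
noncomputable def toPoly (c : MonIdx →₀ ℂ) : MvPolynomial (Fin 2 ⊕ Fin 2) ℂ :=
  c.sum fun k v => C v * X (Sum.inl 0) ^ k.1.1 * X (Sum.inl 1) ^ k.1.2 *
    X (Sum.inr 0) ^ k.2.1 * X (Sum.inr 1) ^ k.2.2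

/-- An element killed by an iterate of a self-map which preserves `S` and has no nontrivial
kernel in `S` is itself zero. -/
theorem eq_zero_of_iterate_eq_zero {α : Type*} [Zero α] {T : α → α} {S : α → Prop}
    (hT : ∀ u, S u → S (T u)) (hker : ∀ u, S u → T u = 0 → u = 0) :
    ∀ (n : ℕ) (v : α), S v → T^[n] v = 0 → v = 0
  | 0, _, _, h => h
  | n + 1, v, hv, h =>
    hker v hv (eq_zero_of_iterate_eq_zero hT hker n (T v) (hT v hv) h)

theorem pderiv_comm {σ : Type*} (i j : σ) (p : MvPolynomial σ ℂ) :
    pderiv i (pderiv j p) = pderiv j (pderiv i p) := by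
  classical
  have h : ⁅pderiv (R := ℂ) i, pderiv (R := ℂ) j⁆ = 0 := by
    refine derivation_ext (R := ℂ) fun k => ?_
    simp [Derivation.commutator_apply, pderiv_X, Pi.single_apply, apply_ite]
  have := congrArg (fun D => D p) h
  simpa [Derivation.commutator_apply, sub_eq_zero] using this

theorem rot_add {σ : Type*} (i j : σ) (p q : MvPolynomial σ ℂ) :
    rot i j (p + q) = rot i j p + rot i j q := by
  simp [rot, mul_add]

theorem rot_zero {σ : Type*} (i j : σ) : rot i j (0 : MvPolynomial σ ℂ) = 0 := by
  simp [rot]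

theorem iterate_rot_add {σ : Type*} (i j : σ) (n : ℕ) (p q : MvPolynomial σ ℂ) :
    (rot i j)^[n] (p + q) = (rot i j)^[n] p + (rot i j)^[n] q := by
  induction n generalizing p q with
  | zero => rfl
  | succ n ih => simp [rot_add, ih]

theorem iterate_rot_zero {σ : Type*} (i j : σ) (n : ℕ) :
    (rot i j)^[n] (0 : MvPolynomial σ ℂ) = 0 :=
  Function.iterate_fixed (rot_zero i j) n

theorem exists_iterate_rot_eq_zero {σ : Type*} {i j : σ} (hij : i ≠ j) (p : MvPolynomial σ ℂ) :
    ∃ n, (rot i j)^[n] p = 0 := by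
  classical
  induction p using MvPolynomial.induction_on' with
  | add p q hp hq =>
    obtain ⟨m, hm⟩ := hp
    obtain ⟨n, hn⟩ := hq
    refine ⟨m + n, ?_⟩
    rw [iterate_rot_add]
    nth_rewrite 1 [add_comm m n]
    rw [Function.iterate_add_apply, Function.iterate_add_apply, hm, hn, iterate_rot_zero,
      iterate_rot_zero, add_zero]
  | monomial s a =>
    suffices h : ∀ (k : ℕ) (s : σ →₀ ℕ) (a : ℂ), s j ≤ k →
        (rot i j)^[k + 1] (monomial s a) = 0 from ⟨_, h (s j) s a le_rfl⟩
    intro k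
    induction k with
    | zero =>
      intro s a hs
      simp [rot, Nat.le_zero.mp hs]
    | succ k ih =>
      intro s a hs
      rw [Function.iterate_succ_apply, rot, pderiv_monomial, X, monomial_mul]
      refine ih _ _ ?_
      simp [hij]
      omega

theorem iterate_bracket_zero_fst (n : ℕ) (g : MvPolynomial (Fin 2) ℂ) :
    bracket^[n] (0, g) = (0, (rot 0 1)^[n] g) := by
  induction n generalizing g with
  | zero => rfl
  | succ n ih => simp [bracket, rot_zero, ih]

theorem iterate_bracket_fst (n : ℕ) (f : MvPolynomial (Fin 2) ℂ × MvPolynomial (Fin 2) ℂ) :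
    (bracket^[n] f).1 = (rot 0 1)^[n] f.1 := by
  induction n generalizing f with
  | zero => rfl
  | succ n ih => simp [ih, bracket]

theorem exists_iterate_bracket_eq_zero
    (f : MvPolynomial (Fin 2) ℂ × MvPolynomial (Fin 2) ℂ) : ∃ n, bracket^[n] f = 0 := by
  have h01 : (0 : Fin 2) ≠ 1 := by decide
  obtain ⟨m, hm⟩ := exists_iterate_rot_eq_zero h01 f.1
  obtain ⟨n, hn⟩ := exists_iterate_rot_eq_zero h01 (bracket^[m] f).2
  refine ⟨n + m, ?_⟩
  have h : bracket^[m] f = (0, (bracket^[m] f).2) :=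
    Prod.ext (by rw [iterate_bracket_fst, hm]) rfl
  rw [Function.iterate_add_apply, h, iterate_bracket_zero_fst, hn]
  rfl

theorem pderiv_inl_hol (i : Fin 2) (f : MvPolynomial (Fin 2) ℂ) :
    pderiv (Sum.inl i) (hol f) = hol (pderiv i f) :=
  pderiv_rename Sum.inl_injective i f

theorem pderiv_inr_antihol (i : Fin 2) (f : MvPolynomial (Fin 2) ℂ) :
    pderiv (Sum.inr i) (antihol f) = antihol (pderiv i f) := by
  rw [antihol, pderiv_rename Sum.inr_injective, pderiv_map, antihol]

theorem pderiv_inr_hol (i : Fin 2) (f : MvPolynomial (Fin 2) ℂ) :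
    pderiv (Sum.inr i) (hol f) = 0 := by
  classical
  refine pderiv_eq_zero_of_notMem_vars fun h => ?_
  simpa using vars_rename Sum.inl f h

theorem pderiv_inl_antihol (i : Fin 2) (f : MvPolynomial (Fin 2) ℂ) :
    pderiv (Sum.inl i) (antihol f) = 0 := by
  classical
  refine pderiv_eq_zero_of_notMem_vars fun h => ?_
  simpa using vars_rename Sum.inr _ h

theorem hol_rot (f : MvPolynomial (Fin 2) ℂ) :
    hol (rot 0 1 f) = X (Sum.inl 0) * hol (pderiv 1 f) := by
  simp [hol, rot]

theorem antihol_rot (f : MvPolynomial (Fin 2) ℂ) :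
    antihol (rot 0 1 f) = X (Sum.inr 0) * antihol (pderiv 1 f) := by
  simp [antihol, rot]

theorem realField_bracket {f : MvPolynomial (Fin 2) ℂ × MvPolynomial (Fin 2) ℂ}
    {P : MvPolynomial (Fin 2 ⊕ Fin 2) ℂ}
    (hP : rot (Sum.inl 0) (Sum.inl 1) P + rot (Sum.inr 0) (Sum.inr 1) P = 0)
    (hf : realField f P = 0) : realField (bracket f) P = 0 := by
  have hP' (i) : pderiv i (rot (Sum.inl 0) (Sum.inl 1) P + rot (Sum.inr 0) (Sum.inr 1) P) = 0 := by
    rw [hP, map_zero]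
  have hf' (i) : pderiv i (realField f P) = 0 := by rw [hf, map_zero]
  have e1 := hP' (Sum.inl 0)
  have e2 := hP' (Sum.inl 1)
  have e3 := hP' (Sum.inr 0)
  have e4 := hP' (Sum.inr 1)
  have d2 := hf' (Sum.inl 1)
  have d4 := hf' (Sum.inr 1)
  have hs : hol (bracket f).2 = hol (rot 0 1 f.2) - hol f.1 := map_sub _ _ _
  have hs' : antihol (bracket f).2 = antihol (rot 0 1 f.2) - antihol f.1 := by
    simp [antihol, bracket]
  simp only [realField, rot, map_add, pderiv_mul, pderiv_inl_hol, pderiv_inr_hol,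
    pderiv_inl_antihol, pderiv_inr_antihol, pderiv_X, Pi.single_apply, reduceCtorEq, if_false,
    Sum.inl.injEq, Sum.inr.injEq, zero_ne_one, if_true, zero_mul, one_mul, zero_add]
    at e1 e2 e3 e4 d2 d4
  rw [pderiv_comm (Sum.inl 0) (Sum.inl 1), pderiv_comm (Sum.inl 0) (Sum.inr 1)] at e1
  rw [pderiv_comm (Sum.inl 1) (Sum.inr 1)] at e2
  rw [pderiv_comm (Sum.inr 0) (Sum.inl 1), pderiv_comm (Sum.inr 0) (Sum.inr 1)] at e3
  rw [pderiv_comm (Sum.inr 1) (Sum.inl 1)] at e4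
  rw [realField, hs, hs']
  simp only [bracket, hol_rot, antihol_rot]
  linear_combination X (Sum.inl 0) * d2 + X (Sum.inr 0) * d4 - hol f.1 * e1 - hol f.2 * e2 -
    antihol f.1 * e3 - antihol f.2 * e4

theorem rot_rot_add {P : MvPolynomial (Fin 2 ⊕ Fin 2) ℂ}
    (hP : rot (Sum.inl 0) (Sum.inl 1) P + rot (Sum.inr 0) (Sum.inr 1) P = 0) :
    rot (Sum.inl 0) (Sum.inl 1) (rot (Sum.inl 0) (Sum.inl 1) P) +
      rot (Sum.inr 0) (Sum.inr 1) (rot (Sum.inl 0) (Sum.inl 1) P) = 0 := by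
  have e := congrArg (pderiv (Sum.inl 1)) hP
  simp only [rot, map_add, pderiv_mul, pderiv_X, Pi.single_apply, reduceCtorEq, if_false,
    Sum.inl.injEq, zero_ne_one, zero_mul, zero_add, map_zero] at e ⊢
  rw [pderiv_comm (Sum.inr 1) (Sum.inl 1)]
  linear_combination X (Sum.inl 0) * e

theorem realField_rot {f : MvPolynomial (Fin 2) ℂ × MvPolynomial (Fin 2) ℂ}
    (hb : bracket f = 0) {P : MvPolynomial (Fin 2 ⊕ Fin 2) ℂ} (hf : realField f P = 0) :
    realField f (rot (Sum.inl 0) (Sum.inl 1) P) = 0 := by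
  have d := congrArg (pderiv (Sum.inl 1)) hf
  have h1 := congrArg (fun g => hol g.1) hb
  have h2 := congrArg (fun g => hol (g.2 + f.1)) hb
  simp only [bracket, sub_add_cancel, hol_rot, Prod.fst_zero, Prod.snd_zero, zero_add] at h1 h2
  have h0 : hol 0 = 0 := map_zero _
  rw [h0] at h1
  simp only [realField, rot, map_add, pderiv_mul, pderiv_inl_hol,
    pderiv_inl_antihol, pderiv_X, Pi.single_apply, reduceCtorEq, if_false,
    Sum.inl.injEq, zero_ne_one, if_true, zero_mul, one_mul, zero_add, map_zero] at d ⊢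
  rw [pderiv_comm (Sum.inl 0) (Sum.inl 1), pderiv_comm (Sum.inr 0) (Sum.inl 1),
    pderiv_comm (Sum.inr 1) (Sum.inl 1)]
  linear_combination X (Sum.inl 0) * d - pderiv (Sum.inl 0) P * h1 - pderiv (Sum.inl 1) P * h2

theorem eq_monomial_of_pderiv_eq_zero {d : ℕ} {f : MvPolynomial (Fin 2) ℂ}
    (hf : f.IsHomogeneous d) (h : pderiv 1 f = 0) : ∃ a, f = C a * X 0 ^ d := by
  refine ⟨coeff (Finsupp.single 0 d) f, ?_⟩
  ext m
  rw [coeff_C_mul, coeff_X_pow]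
  split_ifs with hm
  · rw [← hm, mul_one]
  · rw [mul_zero]
    by_contra hc
    have h1 : m 1 = 0 := by
      by_contra h1
      have := congrArg (coeff (m - Finsupp.single 1 1)) h
      rw [coeff_pderiv, tsub_add_cancel_of_le
        (Finsupp.single_le_iff.mpr (Nat.one_le_iff_ne_zero.mpr h1)), coeff_zero, mul_eq_zero] at this
      exact this.elim hc (Nat.cast_add_one_ne_zero _)
    have h2 := hf hc
    rw [Finsupp.weight_apply, Finsupp.sum_fintype _ _ (by simp)] at h2
    simp [h1] at h2
    refine hm (Finsupp.ext fun i => ?_)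
    fin_cases i <;> simp [h1, h2]

theorem eq_zero_of_rot_eq_zero {d : ℕ} (hd : 2 ≤ d) {a : ℂ} (ha : a ≠ 0)
    {G : MvPolynomial (Fin 2 ⊕ Fin 2) ℂ} (hX : X (Sum.inl 0) ∣ G)
    (hG : C a * X (Sum.inl 0) ^ d * pderiv (Sum.inl 0) G +
      C (starRingEnd ℂ a) * X (Sum.inr 0) ^ d * pderiv (Sum.inr 0) G = 0) : G = 0 := by
  classical
  by_contra hG0
  obtain ⟨s, hs, hmax⟩ := G.support.exists_max_image (fun s => s (Sum.inl 0))
    (support_nonempty.mpr hG0)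
  have hs0 : s (Sum.inl 0) ≠ 0 := by
    intro h0
    obtain ⟨H, rfl⟩ := hX
    exact mem_support_iff.mp hs (by simp [coeff_X_mul', h0])
  have hle : Finsupp.single (Sum.inl 0) 1 ≤ s :=
    Finsupp.single_le_iff.mpr (Nat.one_le_iff_ne_zero.mpr hs0)
  have h := congrArg
    (coeff (Finsupp.single (Sum.inl 0) d + (s - Finsupp.single (Sum.inl 0) 1))) hG
  rw [C_mul_X_pow_eq_monomial, C_mul_X_pow_eq_monomial, coeff_add, coeff_monomial_mul,
    coeff_monomial_mul', coeff_pderiv, tsub_add_cancel_of_le hle, coeff_pderiv] at h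
  set t := Finsupp.single (Sum.inl (0 : Fin 2)) d + (s - Finsupp.single (Sum.inl 0) 1) -
    Finsupp.single (Sum.inr (0 : Fin 2)) d + Finsupp.single (Sum.inr 0) 1 with ht
  have h0 : coeff t G = 0 := by
    by_contra hc
    have := hmax t (mem_support_iff.mpr hc)
    simp [ht] at this
    omega
  rw [h0] at h
  simp [ha, mem_support_iff.mp hs] at h
  exact Nat.cast_add_one_ne_zero _ h

theorem hol_C_mul_X_pow (a : ℂ) (d : ℕ) :
    hol (C a * X 0 ^ d) = C a * X (Sum.inl 0) ^ d := by
  simp [hol]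

theorem antihol_C_mul_X_pow (a : ℂ) (d : ℕ) :
    antihol (C a * X 0 ^ d) = C (starRingEnd ℂ a) * X (Sum.inr 0) ^ d := by
  simp [antihol]

theorem pderiv_eq_zero_of_rot_eq_zero {σ : Type*} {i j : σ} {p : MvPolynomial σ ℂ}
    (h : rot i j p = 0) : pderiv j p = 0 :=
  (mul_eq_zero.mp h).resolve_left (X_ne_zero i)

theorem fst_eq_zero_of_bracket_eq_zero {d : ℕ} (hd : 2 ≤ d)
    {f : MvPolynomial (Fin 2) ℂ × MvPolynomial (Fin 2) ℂ} (hf : f.1.IsHomogeneous d)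
    (hb : bracket f = 0) {P : MvPolynomial (Fin 2 ⊕ Fin 2) ℂ}
    (hP : rot (Sum.inl 0) (Sum.inl 1) P + rot (Sum.inr 0) (Sum.inr 1) P = 0)
    (hP0 : rot (Sum.inl 0) (Sum.inl 1) P ≠ 0) (hfP : realField f P = 0) : f.1 = 0 := by
  obtain ⟨a, ha⟩ := eq_monomial_of_pderiv_eq_zero hf
    (pderiv_eq_zero_of_rot_eq_zero (congrArg Prod.fst hb))
  by_contra hf0
  have ha0 : a ≠ 0 := by
    rintro rfl
    exact hf0 (by simpa using ha)
  obtain ⟨n, hn⟩ := exists_iterate_rot_eq_zero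
    (show (Sum.inl 0 : Fin 2 ⊕ Fin 2) ≠ Sum.inl 1 by simp) (rot (Sum.inl 0) (Sum.inl 1) P)
  refine hP0 (eq_zero_of_iterate_eq_zero (T := rot (Sum.inl 0) (Sum.inl 1))
    (S := fun G => X (Sum.inl 0) ∣ G ∧
      rot (Sum.inl 0) (Sum.inl 1) G + rot (Sum.inr 0) (Sum.inr 1) G = 0 ∧ realField f G = 0)
    ?_ ?_ n _ ⟨dvd_mul_right _ _, rot_rot_add hP, realField_rot hb hfP⟩ hn)
  · rintro G ⟨-, hG, hfG⟩
    exact ⟨dvd_mul_right _ _, rot_rot_add hG, realField_rot hb hfG⟩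
  · rintro G ⟨hX, hG, hfG⟩ hG0
    rw [hG0, zero_add] at hG
    refine eq_zero_of_rot_eq_zero hd ha0 hX ?_
    rwa [realField, pderiv_eq_zero_of_rot_eq_zero hG0, pderiv_eq_zero_of_rot_eq_zero hG, mul_zero,
      mul_zero, add_zero, add_zero, ha, hol_C_mul_X_pow, antihol_C_mul_X_pow] at hfG

theorem eq_zero_of_bracket_eq_zero {d : ℕ} (hd : 2 ≤ d)
    {f : MvPolynomial (Fin 2) ℂ × MvPolynomial (Fin 2) ℂ} (hf1 : f.1.IsHomogeneous d)
    (hf2 : f.2.IsHomogeneous d) (hb : bracket f = 0) {P : MvPolynomial (Fin 2 ⊕ Fin 2) ℂ}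
    (hP : rot (Sum.inl 0) (Sum.inl 1) P + rot (Sum.inr 0) (Sum.inr 1) P = 0)
    (hP0 : rot (Sum.inl 0) (Sum.inl 1) P ≠ 0) (hfP : realField f P = 0) : f = 0 := by
  have h1 := fst_eq_zero_of_bracket_eq_zero hd hf1 hb hP hP0 hfP
  have hb2 : rot 0 1 f.2 = 0 := by simpa [bracket, h1] using congrArg Prod.snd hb
  obtain ⟨b, h2⟩ := eq_monomial_of_pderiv_eq_zero hf2 (pderiv_eq_zero_of_rot_eq_zero hb2)
  have hh : hol 0 = 0 := map_zero _
  have ha : antihol 0 = 0 := by simp [antihol]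
  rw [realField, h1, h2, hh, ha, hol_C_mul_X_pow, antihol_C_mul_X_pow] at hfP
  have hmul : (C b * X (Sum.inl 0) ^ d * X (Sum.inr 0) -
      C (starRingEnd ℂ b) * X (Sum.inr 0) ^ d * X (Sum.inl 0)) *
        rot (Sum.inl 0) (Sum.inl 1) P = 0 := by
    rw [rot, rot] at hP
    rw [rot]
    linear_combination X (Sum.inl 0) * X (Sum.inr 0) * hfP -
      C (starRingEnd ℂ b) * X (Sum.inr 0) ^ d * X (Sum.inl 0) * hP
  have hzero := (mul_eq_zero.mp hmul).resolve_right hP0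
  have e1 := congrArg (eval fun _ => 1) hzero
  have e2 := congrArg (eval (Sum.elim (fun _ => 1) fun _ => 2)) hzero
  simp only [map_sub, map_mul, map_pow, eval_C, eval_X, Sum.elim_inl, Sum.elim_inr, one_pow,
    mul_one, map_zero] at e1 e2
  have hb0 : b * (2 ^ d - 2) = 0 := by linear_combination 2 ^ d * e1 - e2
  have hpow : (2 : ℂ) ^ d - 2 ≠ 0 := by
    have : 2 ^ 1 < 2 ^ d := Nat.pow_lt_pow_right one_lt_two hd
    rw [sub_ne_zero]
    exact_mod_cast this.ne'
  refine Prod.ext h1 ?_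
  rw [h2, (mul_eq_zero.mp hb0).resolve_right hpow]
  simp

theorem isHomogeneous_rot {d : ℕ} (hd : 2 ≤ d) {f : MvPolynomial (Fin 2) ℂ}
    (hf : f.IsHomogeneous d) : (rot 0 1 f).IsHomogeneous d := by
  have h := (isHomogeneous_X ℂ (0 : Fin 2)).mul (hf.pderiv (i := 1))
  rwa [show 1 + (d - 1) = d by omega] at h

theorem eq_zero_of_realField_eq_zero {d : ℕ} (hd : 2 ≤ d)
    {f : MvPolynomial (Fin 2) ℂ × MvPolynomial (Fin 2) ℂ} (hf1 : f.1.IsHomogeneous d)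
    (hf2 : f.2.IsHomogeneous d) {P : MvPolynomial (Fin 2 ⊕ Fin 2) ℂ}
    (hP : rot (Sum.inl 0) (Sum.inl 1) P + rot (Sum.inr 0) (Sum.inr 1) P = 0)
    (hP0 : rot (Sum.inl 0) (Sum.inl 1) P ≠ 0) (hfP : realField f P = 0) : f = 0 := by
  obtain ⟨n, hn⟩ := exists_iterate_bracket_eq_zero f
  refine eq_zero_of_iterate_eq_zero (T := bracket)
    (S := fun g => g.1.IsHomogeneous d ∧ g.2.IsHomogeneous d ∧ realField g P = 0)
    ?_ ?_ n f ⟨hf1, hf2, hfP⟩ hn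
  · rintro g ⟨h1, h2, h⟩
    exact ⟨isHomogeneous_rot hd h1, (isHomogeneous_rot hd h2).sub h1, realField_bracket hP h⟩
  · rintro g ⟨h1, h2, h⟩ hb
    exact eq_zero_of_bracket_eq_zero hd h1 h2 hb hP hP0 h

theorem eq_zero_of_eval_conjPoint {F : MvPolynomial (Fin 2 ⊕ Fin 2) ℂ}
    (h : ∀ z, eval (conjPoint z) F = 0) : F = 0 := by
  set φ : Fin 2 ⊕ Fin 2 → MvPolynomial (Fin 2 ⊕ Fin 2) ℂ :=
    Sum.elim (fun i => X (Sum.inl i) + C I * X (Sum.inr i))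
      (fun i => X (Sum.inl i) - C I * X (Sum.inr i)) with hφ
  have heval (x) : eval x (bind₁ φ F) = eval (fun k => eval x (φ k)) F :=
    eval₂Hom_bind₁ _ _ _ _
  have hF : bind₁ φ F = 0 := by
    refine funext_set (fun _ => Set.range ((↑) : ℝ → ℂ))
      (fun _ => Set.infinite_range_of_injective ofReal_injective) fun x hx => ?_
    choose y hy using fun k => hx k (Set.mem_univ k)
    rw [heval, map_zero,
      ← h (x (Sum.inl 0) + I * x (Sum.inr 0), x (Sum.inl 1) + I * x (Sum.inr 1))]
    congr 2
    ext k
    rcases k with k | k <;> fin_cases k <;> simp [hφ, conjPoint, ← hy, sub_eq_add_neg]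
  refine MvPolynomial.funext fun p => ?_
  rw [map_zero, ← map_zero (eval (Sum.elim
    (fun i => (p (Sum.inl i) + p (Sum.inr i)) / 2)
    (fun i => -I * (p (Sum.inl i) - p (Sum.inr i)) / 2))), ← hF, heval]
  congr 2
  ext k
  rcases k with k | k <;> simp only [hφ, Sum.elim_inl, Sum.elim_inr, map_add, map_sub, map_mul,
    eval_X, eval_C] <;> ring_nf <;> rw [I_sq] <;> ring

theorem eval_hol (f : MvPolynomial (Fin 2) ℂ) (z : ℂ × ℂ) :
    eval (conjPoint z) (hol f) = evalF2 f z := by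
  rw [hol, eval_rename, evalF2]
  rfl

theorem eval_antihol (f : MvPolynomial (Fin 2) ℂ) (z : ℂ × ℂ) :
    eval (conjPoint z) (antihol f) = starRingEnd ℂ (evalF2 f z) := by
  rw [antihol, eval_rename, evalF2, eval_map, eval, coe_eval₂Hom, hom_eval₂]
  congr 1
  ext i
  fin_cases i <;> rfl

theorem eval_pderiv_inl_zero (c : MonIdx →₀ ℂ) (z : ℂ × ℂ) :
    eval (conjPoint z) (pderiv (Sum.inl 0) (toPoly c)) = dz1P c z := by
  simp only [toPoly, Finsupp.sum, map_sum, dz1P]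
  refine Finset.sum_congr rfl fun k _ => ?_
  simp [pderiv_X, conjPoint]
  ring

theorem eval_pderiv_inl_one (c : MonIdx →₀ ℂ) (z : ℂ × ℂ) :
    eval (conjPoint z) (pderiv (Sum.inl 1) (toPoly c)) = dz2P c z := by
  simp only [toPoly, Finsupp.sum, map_sum, dz2P]
  refine Finset.sum_congr rfl fun k _ => ?_
  simp [pderiv_X, conjPoint]
  ring

theorem sum_swap {c : MonIdx →₀ ℂ} (hreal : RealCoeff c) (F G : MonIdx → ℂ → ℂ)
    (hFG : ∀ k v, F k.swap (starRingEnd ℂ v) = G k v) : c.sum F = c.sum G := by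
  have hmem : ∀ k ∈ c.support, k.swap ∈ c.support := fun k hk => by
    rw [Finsupp.mem_support_iff] at hk ⊢
    rw [Prod.swap, hreal k.1 k.2]
    simpa using hk
  refine Finset.sum_nbij' Prod.swap Prod.swap hmem hmem (fun _ _ => rfl) (fun _ _ => rfl) ?_
  intro k _
  rw [← hFG, Prod.swap_swap, Prod.swap, hreal k.1 k.2, Complex.conj_conj]

theorem eval_pderiv_inr_zero {c : MonIdx →₀ ℂ} (hreal : RealCoeff c) (z : ℂ × ℂ) :
    eval (conjPoint z) (pderiv (Sum.inr 0) (toPoly c)) = starRingEnd ℂ (dz1P c z) := by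
  simp only [toPoly, Finsupp.sum, map_sum, dz1P]
  refine sum_swap hreal (fun k v => eval (conjPoint z) (pderiv (Sum.inr 0)
    (C v * X (Sum.inl 0) ^ k.1.1 * X (Sum.inl 1) ^ k.1.2 * X (Sum.inr 0) ^ k.2.1 *
      X (Sum.inr 1) ^ k.2.2)))
    (fun k v => starRingEnd ℂ (v * (k.1.1 : ℂ) * z.1 ^ (k.1.1 - 1) * z.2 ^ k.1.2 *
      (starRingEnd ℂ z.1) ^ k.2.1 * (starRingEnd ℂ z.2) ^ k.2.2)) fun k v => ?_
  simp [pderiv_X, conjPoint]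
  ring

theorem eval_pderiv_inr_one {c : MonIdx →₀ ℂ} (hreal : RealCoeff c) (z : ℂ × ℂ) :
    eval (conjPoint z) (pderiv (Sum.inr 1) (toPoly c)) = starRingEnd ℂ (dz2P c z) := by
  simp only [toPoly, Finsupp.sum, map_sum, dz2P]
  refine sum_swap hreal (fun k v => eval (conjPoint z) (pderiv (Sum.inr 1)
    (C v * X (Sum.inl 0) ^ k.1.1 * X (Sum.inl 1) ^ k.1.2 * X (Sum.inr 0) ^ k.2.1 *
      X (Sum.inr 1) ^ k.2.2)))
    (fun k v => starRingEnd ℂ (v * (k.1.2 : ℂ) * z.1 ^ k.1.1 * z.2 ^ (k.1.2 - 1) *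
      (starRingEnd ℂ z.1) ^ k.2.1 * (starRingEnd ℂ z.2) ^ k.2.2)) fun k v => ?_
  simp [pderiv_X, conjPoint]
  ring

theorem realField_toPoly_eq_zero {c : MonIdx →₀ ℂ} (hreal : RealCoeff c)
    {f1 f2 : MvPolynomial (Fin 2) ℂ}
    (h : ∀ z : ℂ × ℂ, (evalF2 f1 z * dz1P c z + evalF2 f2 z * dz2P c z).re = 0) :
    realField (f1, f2) (toPoly c) = 0 := by
  refine eq_zero_of_eval_conjPoint fun z => ?_
  have hz := add_conj (evalF2 f1 z * dz1P c z + evalF2 f2 z * dz2P c z)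
  rw [h z] at hz
  simp only [realField, map_add, map_mul, eval_hol, eval_antihol, eval_pderiv_inl_zero,
    eval_pderiv_inl_one, eval_pderiv_inr_zero hreal, eval_pderiv_inr_one hreal] at hz ⊢
  simp only [mul_zero, ofReal_zero] at hz
  linear_combination hz

theorem isHomogeneous_of_wHom2 {mu e : ℝ} (hmu : 0 < mu) {d : ℕ} (he : mu * d = e)
    {f : MvPolynomial (Fin 2) ℂ} (hf : WHom2 mu mu e f) : f.IsHomogeneous d := by
  intro m hm
  have h := hf m hm
  rw [← he, ← mul_add] at h
  have h' := mul_left_cancel₀ hmu.ne' h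
  rw [Finsupp.weight_apply, Finsupp.sum_fintype _ _ (by simp)]
  simpa using (by exact_mod_cast h' : m 0 + m 1 = d)

theorem exists_degree_of_wHom2 {mu nu : ℝ} (hmu : 0 < mu) (hnu : 0 < nu)
    {f : MvPolynomial (Fin 2) ℂ} (hf : WHom2 mu mu (nu + mu) f) (hf0 : f ≠ 0) :
    ∃ d : ℕ, 2 ≤ d ∧ mu * d = nu + mu := by
  obtain ⟨m, hm⟩ := ne_zero_iff.mp hf0
  have h := hf m hm
  refine ⟨m 0 + m 1, ?_, by push_cast; linarith⟩
  by_contra! hlt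
  have hle : ((m 0 + m 1 : ℕ) : ℝ) ≤ 1 := by exact_mod_cast Nat.lt_succ_iff.mp hlt
  push_cast at hle
  nlinarith

end NilpotentRotation

open MvPolynomial NilpotentRotation in
/-- if the holomorphically nondegenerate model `M_P` (weights
`μ₁ = μ₂ = μ`) admits the nilpotent rotation `Y = z₁∂_{z₂}`, then every rigid
infinitesimal symmetry `X = f₁∂_{z₁} + f₂∂_{z₂}` of `M_P` which is weighted
homogeneous of weighted degree `ν ∈ (0,1)` vanishes identically;
i.e. `M_P` has no exotic symmetry. -/
theorem stmt_3 (mu : ℝ) (hmu1 : 0 < mu) (hmu2 : mu ≤ 1 / 2)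
    (c : MonIdx →₀ ℂ) (hreal : RealCoeff c)
    -- no pluriharmonic terms
    (hplh : ∀ a : ℕ × ℕ, c (a, (0, 0)) = 0 ∧ c ((0, 0), a) = 0)
    -- P is weighted homogeneous of weighted degree 1 w.r.t. (μ, μ)
    (hwh : ∀ k : MonIdx, c k ≠ 0 →
        mu * ((k.1.1 : ℝ) + (k.2.1 : ℝ)) + mu * ((k.1.2 : ℝ) + (k.2.2 : ℝ)) = 1)
    (hnd : HolNondeg c)
    -- Y = z₁∂_{z₂} is an infinitesimal symmetry: Re(z₁·∂P/∂z₂) ≡ 0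
    (hnil : ∀ z : ℂ × ℂ, (z.1 * dz2P c z).re = 0)
    (nu : ℝ) (hnu1 : 0 < nu) (hnu2 : nu < 1)
    (f1 f2 : MvPolynomial (Fin 2) ℂ)
    (hf1 : WHom2 mu mu (nu + mu) f1) (hf2 : WHom2 mu mu (nu + mu) f2)
    -- X = f₁∂_{z₁} + f₂∂_{z₂} is an infinitesimal symmetry: Re(XP) ≡ 0
    (hsym : ∀ z : ℂ × ℂ, (evalF2 f1 z * dz1P c z + evalF2 f2 z * dz2P c z).re = 0) :
    f1 = 0 ∧ f2 = 0 := by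
  have hrot : rot (Sum.inl 0) (Sum.inl 1) (toPoly c) +
      rot (Sum.inr 0) (Sum.inr 1) (toPoly c) = 0 := by
    have h := realField_toPoly_eq_zero (f1 := 0) (f2 := X 0) hreal fun z => by
      simpa [evalF2] using hnil z
    simpa [realField, hol, antihol, rot] using h
  have hrot0 : rot (Sum.inl 0) (Sum.inl 1) (toPoly c) ≠ 0 := by
    intro h
    refine one_ne_zero (hnd 0 1 fun z => ?_).2
    rw [← eval_pderiv_inl_one, pderiv_eq_zero_of_rot_eq_zero h]
    simp [evalF2]
  by_contra hne
  obtain ⟨d, hd, hdeg⟩ : ∃ d : ℕ, 2 ≤ d ∧ mu * d = nu + mu := by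
    by_cases h1 : f1 = 0
    · exact exists_degree_of_wHom2 hmu1 hnu1 hf2 fun h2 => hne ⟨h1, h2⟩
    · exact exists_degree_of_wHom2 hmu1 hnu1 hf1 h1
  have h := eq_zero_of_realField_eq_zero (f := (f1, f2)) hd
    (isHomogeneous_of_wHom2 hmu1 hdeg hf1) (isHomogeneous_of_wHom2 hmu1 hdeg hf2) hrot hrot0
    (realField_toPoly_eq_zero hreal hsym)
  exact hne ⟨congrArg Prod.fst h, congrArg Prod.snd h⟩
end

section
/- Suppose the holomorphically nondegenerate polynomial model M_P admits a nonzero diagonal rotation Y = λ₁z₁∂_{z₁} + λ₂z₂∂_{z₂} (λ₁, λ₂ ∈ ℂ, Re(YP) ≡ 0) and an exotic symmetry X. Then X is a monomial multiple of a diagonal linear field: there exist θ ∈ ℂ∖{0}, coprime nonnegative integers p, q not both zero, and nonnegative integers α, β such that either X = θ·z₁^α z₂^β (q z₁∂_{z₁} − p z₂∂_{z₂}), or X = θ·z₂^α ∂_{z₁}, or X = θ·z₁^β ∂_{z₂}. -/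
open Complex

open Complex

/-- The monomials of `P` are weighted homogeneous of weighted degree 1 with
respect to the weights `(μ₁, μ₂)`. -/
def WHdeg1 (mu1 mu2 : ℝ) (c : MonIdx →₀ ℂ) : Prop :=
  ∀ k : MonIdx, c k ≠ 0 →
    mu1 * ((k.1.1 : ℝ) + (k.2.1 : ℝ)) + mu2 * ((k.1.2 : ℝ) + (k.2.2 : ℝ)) = 1

/-- `P` contains no pluriharmonic terms. -/
def NoPluriharmonic (c : MonIdx →₀ ℂ) : Prop :=
  ∀ a : ℕ × ℕ, c (a, (0, 0)) = 0 ∧ c ((0, 0), a) = 0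

/-- A necessary algebraic consequence of `(μ₁, μ₂)` being the Catlin multitype
weights of `M_P` at `0`: `(μ₁, μ₂)` is the lexicographic minimum among all
admissible weights for which `P` itself is weighted homogeneous of weighted
degree 1 (every such weight is distinguished, so it dominates the multitype
weights lexicographically). -/
def MultitypeMinimal (mu1 mu2 : ℝ) (c : MonIdx →₀ ℂ) : Prop :=
  ∀ l1 l2 : ℝ, 0 < l2 → l2 ≤ l1 → l1 ≤ 1 / 2 →
    WHdeg1 l1 l2 c → (mu1 < l1 ∨ (mu1 = l1 ∧ mu2 ≤ l2))

/-- All the standing hypotheses on the polynomial model `M_P` of finite Catlin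
multitype given by `Im w = P(z, z̄)`, with coefficient data `c` and Catlin
multitype weights `0 < μ₂ ≤ μ₁ ≤ 1/2`. -/
def IsModel (mu1 mu2 : ℝ) (c : MonIdx →₀ ℂ) : Prop :=
  0 < mu2 ∧ mu2 ≤ mu1 ∧ mu1 ≤ 1 / 2 ∧ RealCoeff c ∧ NoPluriharmonic c ∧
    WHdeg1 mu1 mu2 c ∧ MultitypeMinimal mu1 mu2 c


/-- Laurent exponents on the torus `(ℂˣ)²`. -/
abbrev Exponent := ℤ × ℤ

/-- The complex bilinear pairing of a coefficient vector with an exponent. -/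
def pairing (A : ℂ × ℂ) (a : Exponent) : ℂ := A.1 * a.1 + A.2 * a.2

/-- The weight of an exponent. -/
def weight (mu1 mu2 : ℝ) (a : Exponent) : ℝ := mu1 * a.1 + mu2 * a.2

/-- The exponent of a monomial in `z, z̄`, with integer entries. -/
def intIdx (k : MonIdx) : Exponent × Exponent :=
  ((k.1.1, k.1.2), (k.2.1, k.2.2))

lemma pairing_sub (A : ℂ × ℂ) (a b : Exponent) :
    pairing A (a - b) = pairing A a - pairing A b := by
  simp [pairing]; ring

lemma weight_add (mu1 mu2 : ℝ) (a b : Exponent) :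
    weight mu1 mu2 (a + b) = weight mu1 mu2 a + weight mu1 mu2 b := by
  simp [weight]; ring

lemma weight_sub (mu1 mu2 : ℝ) (a b : Exponent) :
    weight mu1 mu2 (a - b) = weight mu1 mu2 a - weight mu1 mu2 b := by
  simp [weight]; ring

/-- The complexified field `z^α (A₁z₁∂₁ + A₂z₂∂₂) + z̄^β (B₁z̄₁∂̄₁ + B₂z̄₂∂̄₂)` annihilates the
Laurent polynomial with coefficients `C`. -/
def Annihilates (C : Exponent × Exponent →₀ ℂ) (α : Exponent) (A : ℂ × ℂ) (β : Exponent)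
    (B : ℂ × ℂ) : Prop :=
  ∀ a b : Exponent, pairing A (a - α) * C (a - α, b) + pairing B (b - β) * C (a, b - β) = 0

/-- The coefficient vector of the bracket of two monomial multiples of diagonal fields. -/
def bracket (α : Exponent) (A : ℂ × ℂ) (α' : Exponent) (A' : ℂ × ℂ) : ℂ × ℂ :=
  pairing A α' • A' - pairing A' α • A

lemma pairing_bracket (α : Exponent) (A : ℂ × ℂ) (α' : Exponent) (A' : ℂ × ℂ) (a : Exponent) :
    pairing (bracket α A α' A') a = pairing A α' * pairing A' a - pairing A' α * pairing A a := by
  simp [pairing, bracket]; ring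

lemma Annihilates.bracket {C : Exponent × Exponent →₀ ℂ} {α β α' β' : Exponent}
    {A B A' B' : ℂ × ℂ} (h : Annihilates C α A β B) (h' : Annihilates C α' A' β' B') :
    Annihilates C (α + α') (bracket α A α' A') (β + β') (bracket β B β' B') := by
  intro a b
  have e1 := h' (a - α) b
  have e2 := h' a (b - β)
  have e3 := h (a - α') b
  have e4 := h a (b - β')
  rw [sub_right_comm a α' α] at e3
  rw [sub_right_comm b β' β] at e4
  rw [← sub_sub, ← sub_sub]
  simp only [pairing_bracket, pairing_sub] at *
  linear_combination (pairing A a - pairing A α) * e1 + (pairing B b - pairing B β) * e2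
    - (pairing A' a - pairing A' α') * e3 - (pairing B' b - pairing B' β') * e4

lemma exponent_eq_of_weight_eq {mu1 mu2 : ℝ} {l1 l2 : ℂ} (hdet : l1 * mu2 - l2 * mu1 ≠ 0)
    {α β : Exponent} (hw : weight mu1 mu2 α = weight mu1 mu2 β)
    (hp : pairing (l1, l2) α = pairing (l1, l2) β) : α = β := by
  have hw' : (mu1 : ℂ) * α.1 + mu2 * α.2 = mu1 * β.1 + mu2 * β.2 := by
    unfold weight at hw; exact_mod_cast hw
  simp only [pairing] at hp
  have h1 : (l1 * mu2 - l2 * mu1) * ((α.1 : ℂ) - β.1) = 0 := by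
    linear_combination mu2 * hp - l2 * hw'
  have h2 : (l1 * mu2 - l2 * mu1) * ((α.2 : ℂ) - β.2) = 0 := by
    linear_combination l1 * hw' - mu1 * hp
  have h1' := sub_eq_zero.1 ((mul_eq_zero.1 h1).resolve_left hdet)
  have h2' := sub_eq_zero.1 ((mul_eq_zero.1 h2).resolve_left hdet)
  exact Prod.ext (by exact_mod_cast h1') (by exact_mod_cast h2')

/-- A nonzero vector orthogonal to an exponent of positive weight is transverse to the
weights. -/
lemma det_ne_zero_of_pairing_eq_zero {mu1 mu2 : ℝ} {A : ℂ × ℂ} (hA : A ≠ 0)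
    {a : Exponent} (ha : 0 < weight mu1 mu2 a) (hAa : pairing A a = 0) :
    A.1 * mu2 - A.2 * mu1 ≠ 0 := by
  intro h
  have hw : ((weight mu1 mu2 a : ℝ) : ℂ) ≠ 0 := by exact_mod_cast ha.ne'
  simp only [pairing] at hAa
  have e1 : A.1 * (weight mu1 mu2 a : ℝ) = 0 := by
    simp only [weight]; push_cast
    linear_combination mu1 * hAa + a.2 * h
  have e2 : A.2 * (weight mu1 mu2 a : ℝ) = 0 := by
    simp only [weight]; push_cast
    linear_combination mu2 * hAa - a.1 * h
  exact hA (Prod.ext ((mul_eq_zero.1 e1).resolve_right hw) ((mul_eq_zero.1 e2).resolve_right hw))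

/-- Abstract form of the standing hypotheses: positivity of holomorphic weights, and
nondegeneracy. -/
structure WeightedSupport (mu1 mu2 : ℝ) (C : Exponent × Exponent →₀ ℂ) : Prop where
  pos : ∀ a b, C (a, b) ≠ 0 → 0 < weight mu1 mu2 a
  lt_one : ∀ a b, C (a, b) ≠ 0 → weight mu1 mu2 a < 1
  nondeg : ∀ A : ℂ × ℂ, (∀ a b, C (a, b) ≠ 0 → pairing A a = 0) → A = 0

lemma WeightedSupport.eq_zero_of_one_le {mu1 mu2 : ℝ} {C : Exponent × Exponent →₀ ℂ}
    (hC : WeightedSupport mu1 mu2 C) {α β : Exponent} {A B : ℂ × ℂ}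
    (h : Annihilates C α A β B) (hα : 1 ≤ weight mu1 mu2 α) : A = 0 := by
  refine hC.nondeg A fun a b hab => ?_
  have e := h (a + α) b
  have h0 : C (a + α, b - β) = 0 := by
    by_contra hne
    have := hC.lt_one _ _ hne
    have := hC.pos _ _ hab
    rw [weight_add] at *
    linarith
  rw [h0, add_sub_cancel_right, mul_zero, add_zero] at e
  exact (mul_eq_zero.1 e).resolve_right hab

lemma WeightedSupport.exists_top {mu1 mu2 : ℝ} {C : Exponent × Exponent →₀ ℂ}
    (hC : WeightedSupport mu1 mu2 C) : ∃ a b, C (a, b) ≠ 0 ∧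
      ∀ α A β B, Annihilates C α A β B → 0 < weight mu1 mu2 α → pairing A a = 0 := by
  have hne : C.support.Nonempty := by
    by_contra hemp
    rw [Finset.not_nonempty_iff_eq_empty, Finsupp.support_eq_empty] at hemp
    have := hC.nondeg (1, 1) (by simp [hemp])
    simp at this
  obtain ⟨⟨a, b⟩, hk, hmax⟩ := C.support.exists_max_image (fun k => weight mu1 mu2 k.1) hne
  rw [Finsupp.mem_support_iff] at hk
  refine ⟨a, b, hk, fun α A β B h hα => ?_⟩
  have e := h (a + α) b
  have h0 : C (a + α, b - β) = 0 := by
    by_contra hne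
    have := hmax _ (Finsupp.mem_support_iff.2 hne)
    simp only [weight_add] at this
    linarith
  rw [h0, add_sub_cancel_right, mul_zero, add_zero] at e
  exact (mul_eq_zero.1 e).resolve_right hk

lemma pairing_eq_of_bracket_eq_zero {mu1 mu2 : ℝ} {A G : ℂ × ℂ} {a α γ : Exponent}
    (ha : 0 < weight mu1 mu2 a) (hA : A ≠ 0) (hAa : pairing A a = 0) (hGa : pairing G a = 0)
    (hb : bracket α A γ G = 0) : pairing G γ = pairing G α := by
  have hw : ((weight mu1 mu2 a : ℝ) : ℂ) ≠ 0 := by exact_mod_cast ha.ne'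
  have hcross : A.1 * G.2 - A.2 * G.1 = 0 := by
    refine (mul_eq_zero.1 ?_).resolve_right hw
    simp only [pairing] at hAa hGa
    simp only [weight]; push_cast
    linear_combination (mu1 * G.2 - mu2 * G.1) * hAa + (mu2 * A.1 - mu1 * A.2) * hGa
  have e1 := congrArg Prod.fst hb
  have e2 := congrArg Prod.snd hb
  simp only [bracket, pairing, Prod.fst_sub, Prod.snd_sub, Prod.smul_fst, Prod.smul_snd,
    smul_eq_mul, Prod.fst_zero, Prod.snd_zero] at e1 e2
  by_contra hne
  have hne' := sub_ne_zero.2 hne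
  refine hA (Prod.ext ((mul_eq_zero.1 ?_).resolve_right hne')
    ((mul_eq_zero.1 ?_).resolve_right hne')) <;> simp only [pairing]
  · linear_combination e1 + γ.2 * hcross
  · linear_combination e2 - γ.1 * hcross

/-- Two nonzero annihilating monomial fields of the same positive weight have the same exponent:
otherwise brackets produce nonzero annihilating fields of arbitrarily large weight. -/
lemma WeightedSupport.exponent_unique {mu1 mu2 : ℝ}
    {C : Exponent × Exponent →₀ ℂ} (hC : WeightedSupport mu1 mu2 C) {nu : ℝ} (hnu : 0 < nu)
    {α β α' β' : Exponent} {A B A' B' : ℂ × ℂ} (h : Annihilates C α A β B)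
    (h' : Annihilates C α' A' β' B') (hA : A ≠ 0) (hA' : A' ≠ 0)
    (hα : weight mu1 mu2 α = nu) (hα' : weight mu1 mu2 α' = nu) : α = α' := by
  by_contra hne
  obtain ⟨a, b, hab, htop⟩ := hC.exists_top
  have hpos := hC.pos a b hab
  have hgrow : ∀ n : ℕ, ∃ γ G δ D, Annihilates C γ G δ D ∧ G ≠ 0 ∧
      (n + 1) * nu ≤ weight mu1 mu2 γ := by
    intro n
    induction n with
    | zero => exact ⟨α, A, β, B, h, hA, by simp [hα]⟩
    | succ n ih =>
      obtain ⟨γ, G, δ, D, hG, hG0, hγ⟩ := ih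
      by_cases hb : _root_.bracket α A γ G = 0
      · by_cases hb' : _root_.bracket α' A' γ G = 0
        · have hγ0 : 0 < weight mu1 mu2 γ := lt_of_lt_of_le (by positivity) hγ
          have hGa := htop γ G δ D hG hγ0
          have e := pairing_eq_of_bracket_eq_zero hpos hA (htop α A β B h (hα ▸ hnu)) hGa hb
          have e' := pairing_eq_of_bracket_eq_zero hpos hA' (htop α' A' β' B' h' (hα' ▸ hnu))
            hGa hb'
          exact (hne (exponent_eq_of_weight_eq (det_ne_zero_of_pairing_eq_zero hG0 hpos hGa)
            (hα.trans hα'.symm) (e.symm.trans e'))).elim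
        · refine ⟨_, _, _, _, h'.bracket hG, hb', ?_⟩
          rw [weight_add, hα']; push_cast; linarith
      · refine ⟨_, _, _, _, h.bracket hG, hb, ?_⟩
        rw [weight_add, hα]; push_cast; linarith
  obtain ⟨n, hn⟩ := exists_nat_gt (1 / nu)
  obtain ⟨γ, G, δ, D, hG, hG0, hγ⟩ := hgrow n
  rw [div_lt_iff₀ hnu] at hn
  exact hG0 (hC.eq_zero_of_one_le hG (by nlinarith))

/-- The Laurent monomial `z^a z̄^b` as a character of the torus. -/
noncomputable def torusChar (k : Exponent × Exponent) : ℂˣ × ℂˣ →* ℂ where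
  toFun u := (u.1 : ℂ) ^ k.1.1 * (u.2 : ℂ) ^ k.1.2 *
    (starRingEnd ℂ u.1) ^ k.2.1 * (starRingEnd ℂ u.2) ^ k.2.2
  map_one' := by simp
  map_mul' u v := by simp [mul_zpow]; ring

lemma torusChar_apply (k : Exponent × Exponent) (u : ℂˣ × ℂˣ) :
    torusChar k u = (u.1 : ℂ) ^ k.1.1 * (u.2 : ℂ) ^ k.1.2 *
      (starRingEnd ℂ u.1) ^ k.2.1 * (starRingEnd ℂ u.2) ^ k.2.2 := rfl

lemma exponents_eq_of_zpow_mul_conj {a b a' b' : ℤ}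
    (h : ∀ u : ℂˣ, (u : ℂ) ^ a * (starRingEnd ℂ u) ^ b = (u : ℂ) ^ a' * (starRingEnd ℂ u) ^ b') :
    a = a' ∧ b = b' := by
  have hadd : a + b = a' + b' := by
    have h2 := h (Units.mk0 2 two_ne_zero)
    simp only [Units.val_mk0, map_ofNat, ← zpow_add₀ (two_ne_zero (α := ℂ))] at h2
    have h3 : (2 : ℝ) ^ (a + b) = 2 ^ (a' + b') := by
      apply ofReal_injective; push_cast; exact h2
    exact zpow_right_injective₀ (by norm_num) (by norm_num) h3
  have hsub : a - b = a' - b' := by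
    by_contra hne
    have hd : ((a - b - (a' - b') : ℤ) : ℂ) ≠ 0 := by exact_mod_cast sub_ne_zero.2 hne
    set θ : ℝ := Real.pi / (a - b - (a' - b') : ℤ) with hθ
    have hu := h (Units.mk0 (exp (θ * I)) (exp_ne_zero _))
    simp only [Units.val_mk0, ← exp_conj, map_mul, conj_ofReal, conj_I, ← exp_int_mul,
      ← exp_add] at hu
    have hpi : exp (Real.pi * I) = 1 := by
      have hθ' : (Real.pi : ℂ) = θ * ((a - b - (a' - b') : ℤ) : ℂ) := by
        rw [hθ]; push_cast; push_cast at hd; field_simp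
      rw [show (Real.pi : ℂ) * I =
          (a * (θ * I) + b * (θ * -I)) - (a' * (θ * I) + b' * (θ * -I)) by
        rw [hθ']; push_cast; ring, exp_sub, hu, div_self (exp_ne_zero _)]
    rw [exp_pi_mul_I] at hpi
    norm_num at hpi
  constructor <;> omega

lemma torusChar_injective : Function.Injective torusChar := by
  intro k k' h
  have e1 := exponents_eq_of_zpow_mul_conj (a := k.1.1) (b := k.2.1) (a' := k'.1.1) (b' := k'.2.1)
    fun u => by simpa [torusChar_apply] using DFunLike.congr_fun h (u, 1)
  have e2 := exponents_eq_of_zpow_mul_conj (a := k.1.2) (b := k.2.2) (a' := k'.1.2) (b' := k'.2.2)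
    fun u => by simpa [torusChar_apply] using DFunLike.congr_fun h (1, u)
  exact Prod.ext (Prod.ext e1.1 e2.1) (Prod.ext e1.2 e2.2)

lemma linearIndependent_torusChar :
    LinearIndependent ℂ fun k : Exponent × Exponent => (torusChar k : ℂˣ × ℂˣ → ℂ) :=
  (linearIndependent_monoidHom (ℂˣ × ℂˣ) ℂ).comp torusChar torusChar_injective

lemma conj_torusChar (k : Exponent × Exponent) (u : ℂˣ × ℂˣ) :
    starRingEnd ℂ (torusChar k u) = torusChar k.swap u := by
  simp [torusChar_apply]; ring

lemma torusChar_add_left (a b α : Exponent) (u : ℂˣ × ℂˣ) :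
    torusChar (a + α, b) u = (u.1 : ℂ) ^ α.1 * (u.2 : ℂ) ^ α.2 * torusChar (a, b) u := by
  simp [torusChar_apply, zpow_add₀]; ring

/-- A real-part identity between Laurent polynomials, read off coefficientwise. -/
lemma coeff_add_conj_eq_zero (h : Exponent × Exponent →₀ ℂ)
    (hre : ∀ u, (h.sum fun k v => v * torusChar k u).re = 0) (a b : Exponent) :
    h (a, b) + starRingEnd ℂ (h (b, a)) = 0 := by
  set h' : Exponent × Exponent →₀ ℂ :=
    (h.mapRange (starRingEnd ℂ) (map_zero _)).equivMapDomain (Equiv.prodComm _ _) with hh'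
  have hz : h + h' = 0 := by
    refine linearIndependent_iff.1 linearIndependent_torusChar _ ?_
    funext u
    have h1 : h'.sum (fun k v => v * torusChar k u) =
        starRingEnd ℂ (h.sum fun k v => v * torusChar k u) := by
      rw [hh', Finsupp.sum_equivMapDomain, Finsupp.sum_mapRange_index (by simp)]
      simp [Finsupp.sum, conj_torusChar]
    rw [Finsupp.linearCombination_apply, Finsupp.sum_add_index' (by simp)
      (by intros; simp [add_smul])]
    have h2 := add_conj (h.sum fun k v => v * torusChar k u)
    rw [hre, ← h1] at h2
    simpa [Finsupp.sum] using h2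
  have := DFunLike.congr_fun hz (a, b)
  simpa [hh', Finsupp.equivMapDomain_apply] using this

/-- Coefficients of the image of a Laurent polynomial `C` in `z, z̄` under the holomorphic field
`∑ z^α (A₁(α) z₁∂₁ + A₂(α) z₂∂₂)`, the sum over `α ∈ S`. -/
noncomputable def fieldAction (S : Finset Exponent) (A : Exponent → ℂ × ℂ)
    (C : Exponent × Exponent →₀ ℂ) : Exponent × Exponent →₀ ℂ :=
  ∑ α ∈ S, C.sum fun k v => Finsupp.single (k.1 + α, k.2) (pairing (A α) k.1 * v)

lemma fieldAction_apply (S : Finset Exponent) (A : Exponent → ℂ × ℂ)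
    (C : Exponent × Exponent →₀ ℂ) (a b : Exponent) :
    fieldAction S A C (a, b) = ∑ α ∈ S, pairing (A α) (a - α) * C (a - α, b) := by
  rw [fieldAction, Finsupp.finsetSum_apply]
  refine Finset.sum_congr rfl fun α _ => ?_
  rw [Finsupp.sum_apply, Finsupp.sum, Finset.sum_eq_single (a - α, b)]
  · simp
  · rintro ⟨k1, k2⟩ _ hne
    refine Finsupp.single_eq_of_ne ?_
    rintro h
    simp only [Prod.mk.injEq] at h
    exact hne (by rw [h.1, h.2, add_sub_cancel_right])
  · intro h
    simp [Finsupp.notMem_support_iff.1 h]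

lemma sum_fieldAction (S : Finset Exponent) (A : Exponent → ℂ × ℂ)
    (C : Exponent × Exponent →₀ ℂ) (u : ℂˣ × ℂˣ) :
    ((fieldAction S A C).sum fun k v => v * torusChar k u) =
      (∑ α ∈ S, (A α).1 * ((u.1 : ℂ) ^ α.1 * (u.2 : ℂ) ^ α.2)) *
          (C.sum fun k v => k.1.1 * v * torusChar k u) +
        (∑ α ∈ S, (A α).2 * ((u.1 : ℂ) ^ α.1 * (u.2 : ℂ) ^ α.2)) *
          (C.sum fun k v => k.1.2 * v * torusChar k u) := by
  rw [fieldAction, ← Finsupp.sum_finsetSum_index (by simp) (by intros; ring), Finset.sum_mul,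
    Finset.sum_mul, ← Finset.sum_add_distrib]
  refine Finset.sum_congr rfl fun α _ => ?_
  rw [Finsupp.sum_sum_index (by simp) (by intros; ring)]
  simp only [Finsupp.sum_single_index, zero_mul]
  simp only [Finsupp.sum, Finset.mul_sum, ← Finset.sum_add_distrib]
  refine Finset.sum_congr rfl fun k _ => ?_
  rw [torusChar_add_left]
  simp only [pairing]
  ring

/-- The rotation-homogeneous parts of a symmetry: if the field with coefficients `A` is a symmetry
of `C` and all monomials of `C` are invariant under a rotation transverse to the weights, each
monomial part of the field is completed by a conjugate part to an annihilating field. -/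
lemma exists_annihilates {mu1 mu2 nu : ℝ} {l1 l2 : ℂ} (hdet : l1 * mu2 - l2 * mu1 ≠ 0)
    {C : Exponent × Exponent →₀ ℂ} {S : Finset Exponent} {A : Exponent → ℂ × ℂ}
    (hC : ∀ a b, C (a, b) = starRingEnd ℂ (C (b, a)))
    (hrot : ∀ a b, C (a, b) ≠ 0 →
      pairing (l1, l2) a + starRingEnd ℂ (pairing (l1, l2) b) = 0)
    (hS : ∀ α ∈ S, weight mu1 mu2 α = nu)
    (hsym : ∀ a b, fieldAction S A C (a, b) + starRingEnd ℂ (fieldAction S A C (b, a)) = 0)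
    {α : Exponent} (hα : α ∈ S) : ∃ β B, Annihilates C α (A α) β B := by
  have hsym' : ∀ a b, ∑ γ ∈ S, pairing (A γ) (a - γ) * C (a - γ, b) +
      ∑ γ ∈ S, starRingEnd ℂ (pairing (A γ) (b - γ)) * C (a, b - γ) = 0 := by
    intro a b
    have := hsym a b
    rw [fieldAction_apply, fieldAction_apply, map_sum] at this
    simpa only [map_mul, ← hC] using this
  have hfirst : ∀ a b, pairing (l1, l2) a + starRingEnd ℂ (pairing (l1, l2) b) =
      pairing (l1, l2) α → ∑ γ ∈ S, pairing (A γ) (a - γ) * C (a - γ, b) =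
      pairing (A α) (a - α) * C (a - α, b) := by
    intro a b hab
    refine Finset.sum_eq_single_of_mem α hα fun γ hγ hne => ?_
    by_contra h0
    have := hrot _ _ (right_ne_zero_of_mul h0)
    rw [pairing_sub] at this
    exact hne (exponent_eq_of_weight_eq hdet ((hS γ hγ).trans (hS α hα).symm)
      (by linear_combination hab - this))
  have hfirst0 : ∀ a b, pairing (l1, l2) a + starRingEnd ℂ (pairing (l1, l2) b) ≠
      pairing (l1, l2) α → C (a - α, b) = 0 := by
    intro a b hab
    by_contra h0
    have := hrot _ _ h0
    rw [pairing_sub] at this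
    exact hab (by linear_combination this)
  by_cases hex : ∃ β ∈ S, starRingEnd ℂ (pairing (l1, l2) β) = pairing (l1, l2) α
  · obtain ⟨β, hβ, hβα⟩ := hex
    refine ⟨β, (starRingEnd ℂ (A β).1, starRingEnd ℂ (A β).2), fun a b => ?_⟩
    have hB : ∀ d, pairing (starRingEnd ℂ (A β).1, starRingEnd ℂ (A β).2) d =
        starRingEnd ℂ (pairing (A β) d) := by simp [pairing]
    rw [hB]
    by_cases hab : pairing (l1, l2) a + starRingEnd ℂ (pairing (l1, l2) b) = pairing (l1, l2) α
    · have := hsym' a b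
      rw [hfirst a b hab, Finset.sum_eq_single_of_mem β hβ] at this
      · exact this
      · intro γ hγ hne
        by_contra h0
        have h1 := hrot _ _ (right_ne_zero_of_mul h0)
        rw [pairing_sub, map_sub] at h1
        refine hne (exponent_eq_of_weight_eq hdet ((hS γ hγ).trans (hS β hβ).symm)
          ((starRingEnd ℂ).injective ?_))
        linear_combination hab - h1 - hβα
    · rw [hfirst0 a b hab, mul_zero, zero_add]
      by_contra h0
      have h1 := hrot _ _ (right_ne_zero_of_mul h0)
      rw [pairing_sub, map_sub] at h1
      exact hab (by linear_combination h1 + hβα)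
  · push Not at hex
    refine ⟨α, 0, fun a b => ?_⟩
    have hB : ∀ d, pairing 0 d = 0 := by simp [pairing]
    rw [hB, zero_mul, add_zero]
    by_cases hab : pairing (l1, l2) a + starRingEnd ℂ (pairing (l1, l2) b) = pairing (l1, l2) α
    · have := hsym' a b
      rw [hfirst a b hab, Finset.sum_eq_zero, add_zero] at this
      · exact this
      · intro γ hγ
        by_contra h0
        have h1 := hrot _ _ (right_ne_zero_of_mul h0)
        rw [pairing_sub, map_sub] at h1
        exact hex γ hγ (by linear_combination hab - h1)
    · rw [hfirst0 a b hab, mul_zero]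

/-- The exponent of a monomial, shifted down by `e`. -/
def shiftExponent (e : Exponent) (m : Fin 2 →₀ ℕ) : Exponent := (m 0 - e.1, m 1 - e.2)

lemma shiftExponent_injective (e : Exponent) : Function.Injective (shiftExponent e) := by
  intro m m' h
  simp only [shiftExponent, Prod.mk.injEq] at h
  ext i
  fin_cases i
  · have := h.1; simp only [Fin.zero_eta]; omega
  · have := h.2; simp only [Fin.mk_one]; omega

/-- The Laurent coefficients of `z^{-e} f(z)`. -/
noncomputable def shiftedCoeff (f : MvPolynomial (Fin 2) ℂ) (e : Exponent) : Exponent →₀ ℂ :=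
  ∑ m ∈ f.support, Finsupp.single (shiftExponent e m) (f.coeff m)

lemma shiftedCoeff_shiftExponent (f : MvPolynomial (Fin 2) ℂ) (e : Exponent) (m : Fin 2 →₀ ℕ) :
    shiftedCoeff f e (shiftExponent e m) = f.coeff m := by
  rw [shiftedCoeff, Finsupp.finsetSum_apply, Finset.sum_eq_single m]
  · simp
  · intro m' _ hne
    exact Finsupp.single_eq_of_ne fun h => hne (shiftExponent_injective e h.symm)
  · intro h
    simp [MvPolynomial.notMem_support_iff.1 h]

lemma exists_of_shiftedCoeff_ne_zero {f : MvPolynomial (Fin 2) ℂ} {e α : Exponent}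
    (h : shiftedCoeff f e α ≠ 0) : ∃ m, shiftExponent e m = α ∧ f.coeff m ≠ 0 := by
  rw [shiftedCoeff, Finsupp.finsetSum_apply] at h
  obtain ⟨m, hm, hne⟩ := Finset.exists_ne_zero_of_sum_ne_zero h
  refine ⟨m, ?_, MvPolynomial.mem_support_iff.1 hm⟩
  by_contra h'
  exact hne (Finsupp.single_eq_of_ne (Ne.symm h'))

lemma evalF2_eq_sum_shiftedCoeff (f : MvPolynomial (Fin 2) ℂ) (e : Exponent) {S : Finset Exponent}
    (hS : (shiftedCoeff f e).support ⊆ S) (u : ℂˣ × ℂˣ) :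
    evalF2 f (u.1, u.2) = (u.1 : ℂ) ^ e.1 * (u.2 : ℂ) ^ e.2 *
      ∑ α ∈ S, shiftedCoeff f e α * ((u.1 : ℂ) ^ α.1 * (u.2 : ℂ) ^ α.2) := by
  have h := Finsupp.sum_of_support_subset (shiftedCoeff f e) hS
    (fun α v => v * ((u.1 : ℂ) ^ α.1 * (u.2 : ℂ) ^ α.2)) (by simp)
  rw [← h, shiftedCoeff, ← Finsupp.sum_finsetSum_index (by simp) (by intros; ring), evalF2,
    MvPolynomial.eval_eq', Finset.mul_sum]
  refine Finset.sum_congr rfl fun m _ => ?_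
  rw [Finsupp.sum_single_index (by simp), Fin.prod_univ_two]
  simp only [shiftExponent, zpow_sub₀ u.1.ne_zero, zpow_sub₀ u.2.ne_zero, zpow_natCast]
  have h1 := zpow_ne_zero e.1 u.1.ne_zero
  have h2 := zpow_ne_zero e.2 u.2.ne_zero
  simp only [Matrix.cons_val_zero, Matrix.cons_val_one]
  field_simp

lemma eq_monomial_of_shiftedCoeff {f : MvPolynomial (Fin 2) ℂ} {e : Exponent} {m : Fin 2 →₀ ℕ}
    (h : ∀ α ≠ shiftExponent e m, shiftedCoeff f e α = 0) :
    f = MvPolynomial.C (shiftedCoeff f e (shiftExponent e m)) * MvPolynomial.X 0 ^ m 0 *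
      MvPolynomial.X 1 ^ m 1 := by
  have hmon : f = MvPolynomial.monomial m (shiftedCoeff f e (shiftExponent e m)) := by
    ext m'
    rw [MvPolynomial.coeff_monomial]
    split_ifs with hm
    · rw [← hm, shiftedCoeff_shiftExponent]
    · rw [← shiftedCoeff_shiftExponent f e m']
      exact h _ fun h' => hm (shiftExponent_injective e h').symm
  conv_lhs => rw [hmon, MvPolynomial.monomial_eq, Finsupp.prod_fintype _ _ (by simp),
    Fin.prod_univ_two, ← mul_assoc]

lemma eq_zero_of_shiftedCoeff {f : MvPolynomial (Fin 2) ℂ} {e : Exponent}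
    (h : ∀ α, shiftedCoeff f e α = 0) : f = 0 := by
  ext m
  rw [← shiftedCoeff_shiftExponent f e m, h, MvPolynomial.coeff_zero]

lemma intIdx_injective : Function.Injective intIdx := by
  rintro ⟨⟨a, b⟩, ⟨d, e⟩⟩ ⟨⟨a', b'⟩, ⟨d', e'⟩⟩ h
  simp only [intIdx, Prod.mk.injEq, Nat.cast_inj] at h ⊢
  exact h

lemma torusChar_intIdx (k : MonIdx) (u : ℂˣ × ℂˣ) :
    torusChar (intIdx k) u = monFn k (u.1, u.2) := by
  simp [torusChar_apply, intIdx, monFn]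

lemma mul_dz1P (c : MonIdx →₀ ℂ) (z : ℂ × ℂ) :
    z.1 * dz1P c z = c.sum fun k v => k.1.1 * v * monFn k z := by
  simp only [dz1P, Finsupp.sum, Finset.mul_sum, monFn]
  refine Finset.sum_congr rfl fun k _ => ?_
  rcases k with ⟨⟨_ | n, b⟩, d⟩
  · simp
  · simp only [Nat.add_sub_cancel]; ring

lemma mul_dz2P (c : MonIdx →₀ ℂ) (z : ℂ × ℂ) :
    z.2 * dz2P c z = c.sum fun k v => k.1.2 * v * monFn k z := by
  simp only [dz2P, Finsupp.sum, Finset.mul_sum, monFn]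
  refine Finset.sum_congr rfl fun k _ => ?_
  rcases k with ⟨⟨a, _ | n⟩, d⟩
  · simp
  · simp only [Nat.add_sub_cancel]; ring

/-- The coefficients of `P`, extended by zero to integer exponents. -/
noncomputable def intCoeff (c : MonIdx →₀ ℂ) : Exponent × Exponent →₀ ℂ := c.mapDomain intIdx

lemma intCoeff_intIdx (c : MonIdx →₀ ℂ) (k : MonIdx) : intCoeff c (intIdx k) = c k :=
  Finsupp.mapDomain_apply intIdx_injective c k

lemma exists_of_intCoeff_ne_zero {c : MonIdx →₀ ℂ} {k : Exponent × Exponent}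
    (h : intCoeff c k ≠ 0) : ∃ k', intIdx k' = k ∧ c k' ≠ 0 := by
  by_cases hk : k ∈ Set.range intIdx
  · obtain ⟨k', rfl⟩ := hk
    exact ⟨k', rfl, by rwa [intCoeff_intIdx] at h⟩
  · exact (h (Finsupp.mapDomain_of_notMem_range c k hk)).elim

lemma sum_intCoeff (c : MonIdx →₀ ℂ) (g : Exponent × Exponent → ℂ) (u : ℂˣ × ℂˣ) :
    ((intCoeff c).sum fun k v => g k * v * torusChar k u) =
      c.sum fun k v => g (intIdx k) * v * monFn k (u.1, u.2) := by
  rw [intCoeff, Finsupp.sum_mapDomain_index (by simp) (by intros; ring)]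
  simp only [torusChar_intIdx]

/-- The action of a diagonal-type Laurent field on `P` over the torus. -/
lemma sum_fieldAction_intCoeff (c : MonIdx →₀ ℂ) (S : Finset Exponent) (A : Exponent → ℂ × ℂ)
    (u : ℂˣ × ℂˣ) :
    ((fieldAction S A (intCoeff c)).sum fun k v => v * torusChar k u) =
      (u.1 * ∑ α ∈ S, (A α).1 * ((u.1 : ℂ) ^ α.1 * (u.2 : ℂ) ^ α.2)) * dz1P c (u.1, u.2) +
        (u.2 * ∑ α ∈ S, (A α).2 * ((u.1 : ℂ) ^ α.1 * (u.2 : ℂ) ^ α.2)) * dz2P c (u.1, u.2) := by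
  have e1 := mul_dz1P c (u.1, u.2)
  have e2 := mul_dz2P c (u.1, u.2)
  rw [sum_fieldAction, sum_intCoeff c (fun k => (k.1.1 : ℂ)), sum_intCoeff c (fun k => (k.1.2 : ℂ))]
  simp only [intIdx, Int.cast_natCast]
  rw [← e1, ← e2]
  ring

lemma intCoeff_conj {c : MonIdx →₀ ℂ} (hc : RealCoeff c) (a b : Exponent) :
    intCoeff c (a, b) = starRingEnd ℂ (intCoeff c (b, a)) := by
  have key : ∀ a b, intCoeff c (a, b) ≠ 0 →
      intCoeff c (a, b) = starRingEnd ℂ (intCoeff c (b, a)) := by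
    intro a b h
    obtain ⟨⟨k1, k2⟩, hk, _⟩ := exists_of_intCoeff_ne_zero h
    have hk' : intIdx (k2, k1) = (b, a) := by
      simp only [intIdx, Prod.mk.injEq] at hk ⊢; exact hk.symm
    rw [← hk, ← hk', intCoeff_intIdx, intCoeff_intIdx]
    exact hc k2 k1
  by_cases h : intCoeff c (a, b) = 0
  · by_cases h' : intCoeff c (b, a) = 0
    · simp [h, h']
    · rw [key b a h', conj_conj]
  · exact key a b h

lemma IsModel.weight_pos {mu1 mu2 : ℝ} {c : MonIdx →₀ ℂ} (h : IsModel mu1 mu2 c) {a b : Exponent}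
    (hab : intCoeff c (a, b) ≠ 0) : 0 < weight mu1 mu2 a ∧ 0 < weight mu1 mu2 b ∧
      weight mu1 mu2 a + weight mu1 mu2 b = 1 := by
  obtain ⟨h2, h21, -, -, hpl, hw, -⟩ := h
  have h1 : 0 < mu1 := h2.trans_le h21
  have hpos : ∀ n : ℕ × ℕ, n ≠ (0, 0) → 0 < mu1 * n.1 + mu2 * n.2 := by
    rintro ⟨n, m⟩ hnm
    rcases Nat.eq_zero_or_pos n with rfl | hn
    · have hm : 0 < m := Nat.pos_of_ne_zero fun h => hnm (by rw [h])
      positivity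
    · positivity
  obtain ⟨⟨k1, k2⟩, hk, hne⟩ := exists_of_intCoeff_ne_zero hab
  simp only [intIdx, Prod.mk.injEq] at hk
  obtain ⟨rfl, rfl⟩ := hk
  simp only [weight, Int.cast_natCast]
  refine ⟨hpos k1 ?_, hpos k2 ?_, ?_⟩
  · rintro rfl; exact hne (hpl k2).2
  · rintro rfl; exact hne (hpl k1).1
  · have := hw _ hne
    simp only at this
    linarith

lemma evalF2_C_mul_X (A : ℂ) (z : ℂ × ℂ) :
    evalF2 (MvPolynomial.C A * MvPolynomial.X 0) z = A * z.1 ∧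
      evalF2 (MvPolynomial.C A * MvPolynomial.X 1) z = A * z.2 := by
  simp [evalF2]

lemma IsModel.weightedSupport {mu1 mu2 : ℝ} {c : MonIdx →₀ ℂ} (h : IsModel mu1 mu2 c)
    (hnd : HolNondeg c) : WeightedSupport mu1 mu2 (intCoeff c) where
  pos _ _ hab := (h.weight_pos hab).1
  lt_one _ _ hab := by
    have := h.weight_pos hab
    linarith
  nondeg A hA := by
    have := hnd (MvPolynomial.C A.1 * MvPolynomial.X 0) (MvPolynomial.C A.2 * MvPolynomial.X 1) ?_
    · simpa [Prod.ext_iff] using this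
    · intro z
      rw [(evalF2_C_mul_X _ _).1, (evalF2_C_mul_X _ _).2, mul_assoc, mul_assoc, mul_dz1P, mul_dz2P,
        Finsupp.sum, Finsupp.sum, Finset.mul_sum, Finset.mul_sum, ← Finset.sum_add_distrib]
      refine Finset.sum_eq_zero fun k hk => ?_
      have := hA (intIdx k).1 (intIdx k).2
        (by rw [Prod.mk.eta, intCoeff_intIdx]; exact Finsupp.mem_support_iff.1 hk)
      simp only [pairing, intIdx, Int.cast_natCast] at this
      linear_combination c k * monFn k z * this

lemma pairing_rotation {c : MonIdx →₀ ℂ} (hc : RealCoeff c) {l1 l2 : ℂ}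
    (hrot : ∀ z : ℂ × ℂ, (l1 * z.1 * dz1P c z + l2 * z.2 * dz2P c z).re = 0) {a b : Exponent}
    (hab : intCoeff c (a, b) ≠ 0) :
    pairing (l1, l2) a + starRingEnd ℂ (pairing (l1, l2) b) = 0 := by
  have h := coeff_add_conj_eq_zero (fieldAction {0} (fun _ => (l1, l2)) (intCoeff c))
    (fun u => by
      rw [sum_fieldAction_intCoeff, ← hrot (u.1, u.2)]
      congr 1
      simp
      ring) a b
  simp only [fieldAction_apply, Finset.sum_singleton, sub_zero, map_mul, ← intCoeff_conj hc,
    ← add_mul] at h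
  exact (mul_eq_zero.1 h).resolve_right hab

/-- The coefficient vectors of `f₁∂₁ + f₂∂₂`, written as a sum of monomial multiples of diagonal
fields. -/
noncomputable def fieldCoeff (f1 f2 : MvPolynomial (Fin 2) ℂ) (α : Exponent) : ℂ × ℂ :=
  (shiftedCoeff f1 (1, 0) α, shiftedCoeff f2 (0, 1) α)

/-- The exponents occurring in `f₁∂₁ + f₂∂₂`. -/
noncomputable def fieldSupport (f1 f2 : MvPolynomial (Fin 2) ℂ) : Finset Exponent :=
  (shiftedCoeff f1 (1, 0)).support ∪ (shiftedCoeff f2 (0, 1)).support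

lemma mem_fieldSupport {f1 f2 : MvPolynomial (Fin 2) ℂ} {α : Exponent} :
    α ∈ fieldSupport f1 f2 ↔ fieldCoeff f1 f2 α ≠ 0 := by
  simp only [fieldSupport, fieldCoeff, Finset.mem_union, Finsupp.mem_support_iff, ne_eq,
    Prod.mk_eq_zero]
  tauto

lemma sum_fieldAction_fieldCoeff (c : MonIdx →₀ ℂ) (f1 f2 : MvPolynomial (Fin 2) ℂ)
    (u : ℂˣ × ℂˣ) :
    ((fieldAction (fieldSupport f1 f2) (fieldCoeff f1 f2) (intCoeff c)).sum
        fun k v => v * torusChar k u) =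
      evalF2 f1 (u.1, u.2) * dz1P c (u.1, u.2) + evalF2 f2 (u.1, u.2) * dz2P c (u.1, u.2) := by
  rw [sum_fieldAction_intCoeff, evalF2_eq_sum_shiftedCoeff f1 (1, 0)
      (S := fieldSupport f1 f2) Finset.subset_union_left u,
    evalF2_eq_sum_shiftedCoeff f2 (0, 1)
      (S := fieldSupport f1 f2) Finset.subset_union_right u]
  simp [fieldCoeff]

lemma weight_of_mem_fieldSupport {mu1 mu2 nu : ℝ} {f1 f2 : MvPolynomial (Fin 2) ℂ}
    (hf1 : WHom2 mu1 mu2 (nu + mu1) f1) (hf2 : WHom2 mu1 mu2 (nu + mu2) f2) {α : Exponent}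
    (hα : α ∈ fieldSupport f1 f2) : weight mu1 mu2 α = nu := by
  rcases Finset.mem_union.1 hα with h | h <;>
    obtain ⟨m, rfl, hm⟩ := exists_of_shiftedCoeff_ne_zero (Finsupp.mem_support_iff.1 h)
  · have := hf1 m hm
    simp only [weight, shiftExponent]; push_cast; linarith
  · have := hf2 m hm
    simp only [weight, shiftExponent]; push_cast; linarith

lemma fieldAction_ne_zero {c : MonIdx →₀ ℂ} (hnd : HolNondeg c) {f1 f2 : MvPolynomial (Fin 2) ℂ}
    (hX : ¬(f1 = 0 ∧ f2 = 0)) :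
    fieldAction (fieldSupport f1 f2) (fieldCoeff f1 f2) (intCoeff c) ≠ 0 := by
  intro h0
  have hXX : (MvPolynomial.X 0 * MvPolynomial.X 1 : MvPolynomial (Fin 2) ℂ) ≠ 0 :=
    mul_ne_zero (MvPolynomial.X_ne_zero _) (MvPolynomial.X_ne_zero _)
  have := hnd (MvPolynomial.X 0 * MvPolynomial.X 1 * f1)
    (MvPolynomial.X 0 * MvPolynomial.X 1 * f2) ?_
  · exact hX ⟨(mul_eq_zero.1 this.1).resolve_left hXX, (mul_eq_zero.1 this.2).resolve_left hXX⟩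
  · rintro ⟨x, y⟩
    have hev : ∀ f, evalF2 (MvPolynomial.X 0 * MvPolynomial.X 1 * f) (x, y) =
        x * y * evalF2 f (x, y) := by
      intro f; simp [evalF2]
    rw [hev, hev]
    by_cases hx : x = 0
    · simp [hx]
    by_cases hy : y = 0
    · simp [hy]
    have h := sum_fieldAction_fieldCoeff c f1 f2 (Units.mk0 x hx, Units.mk0 y hy)
    rw [h0, Finsupp.sum_zero_index] at h
    simp only [Units.val_mk0] at h
    linear_combination (-(x * y)) * h

/-- If the rotation were parallel to the weights, `P` would be balanced and admit no symmetry of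
positive weight. -/
lemma det_ne_zero_of_symmetry {mu1 mu2 nu : ℝ} {c : MonIdx →₀ ℂ} (hmod : IsModel mu1 mu2 c)
    {l1 l2 : ℂ} (hl : ¬(l1 = 0 ∧ l2 = 0)) (hnu : 0 < nu)
    (hrot : ∀ a b, intCoeff c (a, b) ≠ 0 →
      pairing (l1, l2) a + starRingEnd ℂ (pairing (l1, l2) b) = 0)
    {S : Finset Exponent} {A : Exponent → ℂ × ℂ} (hS : ∀ α ∈ S, weight mu1 mu2 α = nu)
    (hne : fieldAction S A (intCoeff c) ≠ 0)
    (hsym : ∀ a b, fieldAction S A (intCoeff c) (a, b) +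
      starRingEnd ℂ (fieldAction S A (intCoeff c) (b, a)) = 0) :
    l1 * mu2 - l2 * mu1 ≠ 0 := by
  intro hdet
  have hmu2 : (mu2 : ℂ) ≠ 0 := by exact_mod_cast hmod.1.ne'
  set κ : ℂ := l2 / mu2 with hκ
  have h2 : l2 = κ * mu2 := by rw [hκ]; field_simp
  have h1 : l1 = κ * mu1 := by
    rw [hκ]; field_simp; linear_combination hdet
  have hκ0 : κ ≠ 0 := by
    rintro h; exact hl ⟨by rw [h1, h, zero_mul], by rw [h2, h, zero_mul]⟩
  have hp : ∀ a, pairing (l1, l2) a = κ * (weight mu1 mu2 a : ℝ) := by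
    intro a; simp only [pairing, weight, h1, h2]; push_cast; ring
  have hhalf : ∀ a b, intCoeff c (a, b) ≠ 0 →
      weight mu1 mu2 a = 1 / 2 ∧ weight mu1 mu2 b = 1 / 2 := by
    intro a b hab
    obtain ⟨ha, hb, hsum⟩ := hmod.weight_pos hab
    have h := hrot a b hab
    rw [hp, hp, map_mul, conj_ofReal] at h
    have hn := congrArg norm (eq_neg_of_add_eq_zero_left h)
    rw [norm_neg, norm_mul, norm_mul, RCLike.norm_conj, norm_real, norm_real,
      Real.norm_of_nonneg ha.le, Real.norm_of_nonneg hb.le] at hn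
    have := mul_left_cancel₀ (norm_ne_zero_iff.2 hκ0) hn
    constructor <;> linarith
  have hw : ∀ a b, fieldAction S A (intCoeff c) (a, b) ≠ 0 →
      weight mu1 mu2 a = 1 / 2 + nu ∧ weight mu1 mu2 b = 1 / 2 := by
    intro a b hab
    rw [fieldAction_apply] at hab
    obtain ⟨α, hα, h⟩ := Finset.exists_ne_zero_of_sum_ne_zero hab
    have h' := hhalf _ _ (right_ne_zero_of_mul h)
    rw [weight_sub, hS α hα] at h'
    exact ⟨by linarith, h'.2⟩
  refine hne (Finsupp.ext ?_)
  rintro ⟨a, b⟩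
  by_contra h
  have hba : fieldAction S A (intCoeff c) (b, a) ≠ 0 := by
    intro h0
    have := hsym a b
    rw [h0, map_zero, add_zero] at this
    exact h this
  have := (hw a b h).2
  have := (hw b a hba).1
  linarith

/-- A nonzero vector orthogonal to a nonzero pair of naturals is a multiple of `(q, -p)` with
`p`, `q` coprime. -/
lemma exists_coprime_of_pairing_eq_zero {A : ℂ × ℂ} (hA : A ≠ 0) {s t : ℕ}
    (hst : ¬(s = 0 ∧ t = 0)) (h : A.1 * s + A.2 * t = 0) :
    ∃ (θ : ℂ) (p q : ℕ), θ ≠ 0 ∧ Nat.gcd p q = 1 ∧ ¬(p = 0 ∧ q = 0) ∧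
      A.1 = θ * q ∧ A.2 = -(θ * p) := by
  have hg : 0 < Nat.gcd s t := Nat.pos_of_ne_zero fun h0 => hst (Nat.gcd_eq_zero_iff.1 h0)
  obtain ⟨g, p, q, hg0, hpq, rfl, rfl⟩ := Nat.exists_coprime' hg
  have hgC : (g : ℂ) ≠ 0 := by exact_mod_cast hg0.ne'
  have hAp : A.1 * p + A.2 * q = 0 := by
    refine (mul_eq_zero.1 ?_).resolve_right hgC
    push_cast at h
    linear_combination h
  have hpq0 : ¬(p = 0 ∧ q = 0) := by
    rintro ⟨rfl, rfl⟩; simp at hst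
  have hex : ∃ θ : ℂ, A.1 = θ * q ∧ A.2 = -(θ * p) := by
    by_cases hq : q = 0
    · subst hq
      have hp : p = 1 := by simpa using hpq
      subst hp
      exact ⟨-A.2, by simpa using hAp, by simp⟩
    · have hq' : (q : ℂ) ≠ 0 := by exact_mod_cast hq
      refine ⟨A.1 / q, by field_simp, ?_⟩
      field_simp
      linear_combination hAp
  obtain ⟨θ, e1, e2⟩ := hex
  refine ⟨θ, p, q, ?_, hpq, hpq0, e1, e2⟩
  rintro rfl
  exact hA (Prod.ext (by simpa using e1) (by simpa using e2))

lemma exists_finsupp (x y : ℕ) : ∃ m : Fin 2 →₀ ℕ, m 0 = x ∧ m 1 = y :=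
  ⟨Finsupp.equivFunOnFinite.symm ![x, y], by simp, by simp⟩

/-- if the holomorphically nondegenerate model `M_P` admits a nonzero
diagonal rotation `Y = λ₁z₁∂_{z₁} + λ₂z₂∂_{z₂}` (`λ₁, λ₂ ∈ ℂ`) and an exotic
symmetry `X = f₁∂_{z₁} + f₂∂_{z₂}`, then `X` is a monomial multiple of a diagonal
linear field: `X = θ·z₁^α z₂^β (q z₁∂_{z₁} − p z₂∂_{z₂})`, or `X = θ·z₂^α ∂_{z₁}`,
or `X = θ·z₁^β ∂_{z₂}`, with `θ ≠ 0` and `p, q` coprime, not both zero. -/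
theorem stmt_7 (mu1 mu2 : ℝ) (c : MonIdx →₀ ℂ)
    (hmod : IsModel mu1 mu2 c) (hnd : HolNondeg c)
    -- the nonzero diagonal rotation Y
    (l1 l2 : ℂ) (hl : ¬(l1 = 0 ∧ l2 = 0))
    (hrot : ∀ z : ℂ × ℂ, (l1 * z.1 * dz1P c z + l2 * z.2 * dz2P c z).re = 0)
    -- the exotic symmetry X = f₁∂_{z₁} + f₂∂_{z₂}, of weighted degree ν ∈ (0,1)
    (f1 f2 : MvPolynomial (Fin 2) ℂ) (hX : ¬(f1 = 0 ∧ f2 = 0))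
    (nu : ℝ) (hnu1 : 0 < nu) (hnu2 : nu < 1)
    (hf1 : WHom2 mu1 mu2 (nu + mu1) f1) (hf2 : WHom2 mu1 mu2 (nu + mu2) f2)
    (hsym : ∀ z : ℂ × ℂ, (evalF2 f1 z * dz1P c z + evalF2 f2 z * dz2P c z).re = 0) :
    ∃ (th : ℂ) (p q al be : ℕ), th ≠ 0 ∧ Nat.gcd p q = 1 ∧ ¬(p = 0 ∧ q = 0) ∧
      ((f1 = MvPolynomial.C (th * q) * MvPolynomial.X 0 ^ (al + 1) * MvPolynomial.X 1 ^ be ∧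
        f2 = MvPolynomial.C (-(th * p)) * MvPolynomial.X 0 ^ al * MvPolynomial.X 1 ^ (be + 1)) ∨
       (f1 = MvPolynomial.C th * MvPolynomial.X 1 ^ al ∧ f2 = 0) ∨
       (f1 = 0 ∧ f2 = MvPolynomial.C th * MvPolynomial.X 0 ^ be)) := by
  have hC := hmod.weightedSupport hnd
  have hreal : RealCoeff c := hmod.2.2.2.1
  have hrotC := fun a b => pairing_rotation hreal hrot (a := a) (b := b)
  have hw := fun α hα => weight_of_mem_fieldSupport hf1 hf2 (α := α) hα
  have hne := fieldAction_ne_zero hnd hX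
  have hsymC := coeff_add_conj_eq_zero
    (fieldAction (fieldSupport f1 f2) (fieldCoeff f1 f2) (intCoeff c))
    (fun u => by rw [sum_fieldAction_fieldCoeff]; exact hsym _)
  have hdet := det_ne_zero_of_symmetry hmod hl hnu1 hrotC hw hne hsymC
  have hann := fun α hα => exists_annihilates hdet (intCoeff_conj hreal) hrotC hw hsymC (α := α) hα
  obtain ⟨α, hα⟩ : (fieldSupport f1 f2).Nonempty := by
    by_contra hemp
    rw [Finset.not_nonempty_iff_eq_empty] at hemp
    exact hne (by rw [hemp, fieldAction, Finset.sum_empty])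
  have hA := mem_fieldSupport.1 hα
  have hzero : ∀ γ ≠ α, fieldCoeff f1 f2 γ = 0 := by
    intro γ hγ
    by_contra h
    have hγS := mem_fieldSupport.2 h
    obtain ⟨β, B, hB⟩ := hann α hα
    obtain ⟨β', B', hB'⟩ := hann γ hγS
    exact hγ (hC.exponent_unique hnu1 hB' hB h hA (hw γ hγS) (hw α hα))
  have hz1 : ∀ γ ≠ α, shiftedCoeff f1 (1, 0) γ = 0 := fun γ hγ => congrArg Prod.fst (hzero γ hγ)
  have hz2 : ∀ γ ≠ α, shiftedCoeff f2 (0, 1) γ = 0 := fun γ hγ => congrArg Prod.snd (hzero γ hγ)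
  by_cases hpos : 0 ≤ α.1 ∧ 0 ≤ α.2
  · obtain ⟨a, b, hab, htop⟩ := hC.exists_top
    obtain ⟨β, B, hB⟩ := hann α hα
    have hAa := htop α _ β B hB (by rw [hw α hα]; exact hnu1)
    have ha := hC.pos a b hab
    obtain ⟨⟨⟨s, t⟩, k⟩, hk, -⟩ := exists_of_intCoeff_ne_zero hab
    obtain rfl : ((s : ℤ), (t : ℤ)) = a := congrArg Prod.fst hk
    obtain ⟨th, p, q, hth, hpq, hpq0, e1, e2⟩ := exists_coprime_of_pairing_eq_zero hA (s := s)
      (t := t) (by rintro ⟨rfl, rfl⟩; simp [weight] at ha) (by simpa [pairing] using hAa)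
    obtain ⟨x, y⟩ := α
    lift x to ℕ using hpos.1
    lift y to ℕ using hpos.2
    refine ⟨th, p, q, x, y, hth, hpq, hpq0, Or.inl ⟨?_, ?_⟩⟩
    · obtain ⟨m, hm0, hm1⟩ := exists_finsupp (x + 1) y
      have hm : shiftExponent (1, 0) m = ((x : ℤ), (y : ℤ)) := by simp [shiftExponent, hm0, hm1]
      have h := eq_monomial_of_shiftedCoeff (m := m) (hm ▸ hz1)
      rw [hm, hm0, hm1] at h
      rwa [← e1]
    · obtain ⟨m, hm0, hm1⟩ := exists_finsupp x (y + 1)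
      have hm : shiftExponent (0, 1) m = ((x : ℤ), (y : ℤ)) := by simp [shiftExponent, hm0, hm1]
      have h := eq_monomial_of_shiftedCoeff (m := m) (hm ▸ hz2)
      rw [hm, hm0, hm1] at h
      rwa [← e2]
  · by_cases h1 : shiftedCoeff f1 (1, 0) α = 0
    · have h2 : shiftedCoeff f2 (0, 1) α ≠ 0 := fun h => hA (Prod.ext h1 h)
      have hf1 : f1 = 0 := eq_zero_of_shiftedCoeff fun γ => by
        by_cases hγ : γ = α
        · rw [hγ, h1]
        · exact hz1 γ hγ
      obtain ⟨m, rfl, -⟩ := exists_of_shiftedCoeff_ne_zero h2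
      have hm1 : m 1 = 0 := by simp only [shiftExponent] at hpos; omega
      refine ⟨_, 1, 0, 0, m 0, h2, by simp, by simp, Or.inr (Or.inr ⟨hf1, ?_⟩)⟩
      simpa [hm1] using eq_monomial_of_shiftedCoeff hz2
    · obtain ⟨m, rfl, -⟩ := exists_of_shiftedCoeff_ne_zero h1
      have hm0 : m 0 = 0 := by simp only [shiftExponent] at hpos; omega
      have hf2 : f2 = 0 := eq_zero_of_shiftedCoeff fun γ => by
        by_contra hγ
        obtain rfl : γ = shiftExponent (1, 0) m := by
          by_contra h
          exact hγ (hz2 γ h)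
        obtain ⟨m', hm', -⟩ := exists_of_shiftedCoeff_ne_zero hγ
        simp only [shiftExponent, Prod.mk.injEq] at hm' hpos
        omega
      refine ⟨_, 1, 0, m 1, 0, h1, by simp, by simp, Or.inr (Or.inl ⟨?_, hf2⟩)⟩
      simpa [hm0] using eq_monomial_of_shiftedCoeff hz1
end
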